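/- Let (W,S) be a Coxeter system with special subgroups A = W_{S_A} and B = W_{S_B}, let w ∈ W, and let d be the unique element of minimal length in the double coset AwB. If A ⊆ wBw⁻¹, then S_A ⊆ dS_Bd⁻¹. -/

import Mathlib

open CoxeterSystem

namespace CoxFA

variable {B : Type*}

/-- The special subgroup of `W` generated by the simple reflections indexed by `T`. -/
def sp {W : Type*} [Group W] {M : CoxeterMatrix B} (cs : CoxeterSystem M W) (T : Set B) :
    Subgroup W :=
  Subgroup.closure (cs.simple '' T)

/-- The conjugate subgroup `w H w⁻¹`. -/
def conjSub {W : Type*} [Group W] (w : W) (H : Subgroup W) : Subgroup W :=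
  H.map (MulAut.conj w).toMonoidHom

section Exchange

variable {W : Type*} [Group W] {M : CoxeterMatrix B} (cs : CoxeterSystem M W)

open Classical in
/-- The action of a simple reflection on pairs `(t, ε)`: conjugate `t` by the reflection, and flip
the sign `ε` if `t` is that reflection. -/
noncomputable def signedConj (i : B) : Function.End (W × ZMod 2) := fun p =>
  (cs.simple i * p.1 * cs.simple i, p.2 + if p.1 = cs.simple i then 1 else 0)

open Classical in
theorem signedConj_mul_pow_apply (i j : B) (n : ℕ) (t : W) (ε : ZMod 2) :
    ((signedConj cs i * signedConj cs j) ^ n) (t, ε) =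
      ((cs.simple i * cs.simple j) ^ n * t * ((cs.simple i * cs.simple j) ^ n)⁻¹,
        ε + ∑ k ∈ Finset.range (2 * n),
          if t = cs.simple j * (cs.simple i * cs.simple j) ^ k then 1 else 0) := by
  set r := cs.simple i * cs.simple j with hr
  have hrj : ∀ k : ℕ, (r ^ k)⁻¹ * cs.simple j = cs.simple j * r ^ k := by
    intro k
    induction k with
    | zero => simp
    | succ k ih =>
      rw [pow_succ, mul_inv_rev, mul_assoc, ih, ← pow_succ, pow_succ']
      simp [hr, mul_assoc]
  induction n with
  | zero => simp; rfl
  | succ n ih =>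
    have step : ((signedConj cs i * signedConj cs j) ^ (n + 1)) (t, ε) =
        signedConj cs i (signedConj cs j (((signedConj cs i * signedConj cs j) ^ n) (t, ε))) := by
      rw [pow_succ']; rfl
    rw [step, ih, show 2 * (n + 1) = 2 * n + 1 + 1 by ring, Finset.sum_range_succ,
      Finset.sum_range_succ]
    have h1 : r ^ n * t * (r ^ n)⁻¹ = cs.simple j ↔ t = cs.simple j * r ^ (2 * n) := by
      rw [mul_inv_eq_iff_eq_mul, ← eq_inv_mul_iff_mul_eq, ← mul_assoc, hrj, mul_assoc, ← pow_add,
        two_mul]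
    have h2 : cs.simple j * (r ^ n * t * (r ^ n)⁻¹) * cs.simple j = cs.simple i ↔
        t = cs.simple j * r ^ (2 * n + 1) := by
      have : cs.simple j * (r ^ n * t * (r ^ n)⁻¹) * cs.simple j = cs.simple i ↔
          r ^ n * t * (r ^ n)⁻¹ = cs.simple j * r := by
        generalize r ^ n * t * (r ^ n)⁻¹ = x
        constructor
        · intro h
          rw [hr, ← h]
          simp [mul_assoc]
        · intro h
          rw [h]
          simp [hr, mul_assoc]
      rw [this, mul_inv_eq_iff_eq_mul, ← eq_inv_mul_iff_mul_eq, ← mul_assoc, ← mul_assoc, hrj,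
        mul_assoc, mul_assoc, ← pow_succ', ← pow_add]
      ring_nf
    simp only [signedConj, h1, h2]
    refine Prod.ext ?_ ?_
    · simp [pow_succ', hr, mul_assoc]
    · simp only [add_assoc]

theorem isLiftable_signedConj : M.IsLiftable (signedConj cs) := by
  classical
  intro i j
  funext ⟨t, ε⟩
  rw [signedConj_mul_pow_apply, two_mul, Finset.sum_range_add]
  simp only [pow_add, cs.simple_mul_simple_pow, one_mul, inv_one, mul_one]
  rw [CharTwo.add_self_eq_zero, add_zero]
  rfl

/-- The action of `W` on signed elements extending `signedConj`. -/
noncomputable def signedConjHom : W →* Function.End (W × ZMod 2) :=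
  cs.lift ⟨signedConj cs, isLiftable_signedConj cs⟩

theorem signedConjHom_simple (i : B) : signedConjHom cs (cs.simple i) = signedConj cs i :=
  cs.lift_apply_simple (isLiftable_signedConj cs) i

open Classical in
theorem signedConjHom_wordProd (ω : List B) (t : W) (ε : ZMod 2) :
    signedConjHom cs (cs.wordProd ω) (t, ε) =
      (cs.wordProd ω * t * (cs.wordProd ω)⁻¹, ε + ((cs.rightInvSeq ω).count t : ZMod 2)) := by
  induction ω with
  | nil => simp; rfl
  | cons i ω ih =>
    have step : signedConjHom cs (cs.wordProd (i :: ω)) (t, ε) =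
        signedConj cs i (signedConjHom cs (cs.wordProd ω) (t, ε)) := by
      rw [cs.wordProd_cons, map_mul, signedConjHom_simple]; rfl
    rw [step, ih]
    have h : cs.wordProd ω * t * (cs.wordProd ω)⁻¹ = cs.simple i ↔
        (cs.wordProd ω)⁻¹ * cs.simple i * cs.wordProd ω = t := by
      rw [mul_inv_eq_iff_eq_mul, mul_assoc, inv_mul_eq_iff_eq_mul, eq_comm]
    refine Prod.ext ?_ ?_
    · simp [signedConj, cs.wordProd_cons, mul_assoc]
    · simp only [signedConj, h, rightInvSeq, List.count_cons, beq_iff_eq]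
      push_cast
      rw [add_assoc]

/-- A right descent of the product of a word (reduced or not) occurs in the right inversion
sequence of that word. -/
theorem simple_mem_rightInvSeq_of_isRightDescent {ω : List B} {i : B}
    (h : cs.IsRightDescent (cs.wordProd ω) i) : cs.simple i ∈ cs.rightInvSeq ω := by
  classical
  by_contra hmem
  obtain ⟨ω', hred, hω'⟩ := cs.exists_isReduced (cs.wordProd ω * cs.simple i)
  have hnot : cs.simple i ∉ cs.rightInvSeq ω' := by
    intro hi
    have := (cs.isRightInversion_of_mem_rightInvSeq hred hi).2
    rw [← hω', cs.simple_mul_simple_cancel_right] at this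
    exact lt_asymm h this
  have e1 := signedConjHom_wordProd cs ω (cs.simple i) 0
  have e2 := signedConjHom_wordProd cs ω' (cs.simple i) 1
  rw [List.count_eq_zero_of_not_mem hmem] at e1
  rw [List.count_eq_zero_of_not_mem hnot, ← hω', map_mul, signedConjHom_simple] at e2
  have e3 : signedConjHom cs (cs.wordProd ω) (signedConj cs i (cs.simple i, 1)) =
      signedConjHom cs (cs.wordProd ω) (cs.simple i, 0) := by
    simp [signedConj, CharTwo.add_self_eq_zero]
  have e4 := congrArg Prod.snd (e2.symm.trans (e3.trans e1))
  simp at e4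

/-- The exchange property. -/
theorem exists_eraseIdx_of_isRightDescent {ω : List B} {i : B}
    (h : cs.IsRightDescent (cs.wordProd ω) i) :
    ∃ j < ω.length, cs.wordProd ω * cs.simple i = cs.wordProd (ω.eraseIdx j) := by
  obtain ⟨j, hj, hji⟩ := List.getElem_of_mem (simple_mem_rightInvSeq_of_isRightDescent cs h)
  refine ⟨j, by simpa using hj, ?_⟩
  rw [← cs.wordProd_mul_getD_rightInvSeq, List.getD_eq_getElem _ _ hj, hji]

theorem wordProd_mem_sp {T : Set B} {ω : List B} (h : ∀ i ∈ ω, i ∈ T) :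
    cs.wordProd ω ∈ sp cs T := by
  induction ω with
  | nil => simp [one_mem]
  | cons i ω ih =>
    rw [cs.wordProd_cons]
    exact mul_mem (Subgroup.subset_closure ⟨i, h i (by simp), rfl⟩)
      (ih fun k hk => h k (by simp [hk]))

theorem exists_wordProd_of_mem_sp {T : Set B} {b : W} (hb : b ∈ sp cs T) :
    ∃ ω : List B, (∀ i ∈ ω, i ∈ T) ∧ cs.wordProd ω = b := by
  induction hb using Subgroup.closure_induction with
  | mem x hx =>
    obtain ⟨i, hi, rfl⟩ := hx
    exact ⟨[i], by simpa using hi, by simp⟩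
  | one => exact ⟨[], by simp, by simp⟩
  | mul x y _ _ hx hy =>
    obtain ⟨u, hu, rfl⟩ := hx
    obtain ⟨v, hv, rfl⟩ := hy
    refine ⟨u ++ v, fun i hi => ?_, cs.wordProd_append u v⟩
    exact (List.mem_append.1 hi).elim (hu i) (hv i)
  | inv x _ hx =>
    obtain ⟨u, hu, rfl⟩ := hx
    exact ⟨u.reverse, fun i hi => hu i (List.mem_reverse.1 hi), cs.wordProd_reverse u⟩

/-- A word in the letters `T` which is shortest among the words in `T` with the same product. -/
def IsShortestIn (T : Set B) (ω : List B) : Prop :=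
  (∀ i ∈ ω, i ∈ T) ∧ ∀ ω' : List B, (∀ i ∈ ω', i ∈ T) → cs.wordProd ω' = cs.wordProd ω →
    ω.length ≤ ω'.length

theorem exists_isShortestIn {T : Set B} {b : W} (hb : b ∈ sp cs T) :
    ∃ ω : List B, IsShortestIn cs T ω ∧ cs.wordProd ω = b := by
  obtain ⟨ω, ⟨hT, hω⟩, hmin⟩ := exists_minimalFor_of_wellFoundedLT
    (fun ω : List B => (∀ i ∈ ω, i ∈ T) ∧ cs.wordProd ω = b) List.length
    (exists_wordProd_of_mem_sp cs hb)
  refine ⟨ω, ⟨hT, fun ω' h' e => ?_⟩, hω⟩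
  exact (le_total ω.length ω'.length).elim id fun hle => hmin ⟨h', e.trans hω⟩ hle

/-- If `d` has minimal length in `d W_T`, then lengths add along `d W_T`. -/
theorem length_mul_wordProd_of_isShortestIn {T : Set B} {d : W}
    (hd : ∀ b ∈ sp cs T, cs.length d ≤ cs.length (d * b)) {ω : List B}
    (hω : IsShortestIn cs T ω) :
    cs.length (d * cs.wordProd ω) = cs.length d + ω.length := by
  induction ω using List.reverseRecOn with
  | nil => simp
  | append_singleton ω i ih =>
    obtain ⟨hT, hmin⟩ := hω
    have hTω : ∀ k ∈ ω, k ∈ T := fun k hk => hT k (by simp [hk])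
    have hi : i ∈ T := hT i (by simp)
    have hshort : IsShortestIn cs T ω := by
      refine ⟨hTω, fun ω' h' e => ?_⟩
      have := hmin (ω' ++ [i]) (by simpa [or_imp, forall_and] using ⟨h', hi⟩)
        (by rw [cs.wordProd_append, cs.wordProd_append, e])
      simpa using this
    have key : ¬ cs.IsRightDescent (d * cs.wordProd ω) i := by
      intro hdesc
      obtain ⟨v, hv, rfl⟩ := cs.exists_isReduced d
      rw [← cs.wordProd_append] at hdesc
      obtain ⟨j, hj, e⟩ := exists_eraseIdx_of_isRightDescent cs hdesc
      rw [cs.wordProd_append] at e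
      by_cases hjv : j < v.length
      · rw [List.eraseIdx_append_of_lt_length hjv, cs.wordProd_append] at e
        have hb : cs.wordProd ω * cs.simple i * (cs.wordProd ω)⁻¹ ∈ sp cs T :=
          mul_mem (mul_mem (wordProd_mem_sp cs hTω) (Subgroup.subset_closure ⟨i, hi, rfl⟩))
            (inv_mem (wordProd_mem_sp cs hTω))
        have e' : cs.wordProd v * (cs.wordProd ω * cs.simple i * (cs.wordProd ω)⁻¹) =
            cs.wordProd (v.eraseIdx j) := by
          rw [← mul_assoc, ← mul_assoc, e, mul_inv_cancel_right]
        have hle := hd _ hb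
        rw [e', hv.eq] at hle
        have := hle.trans (cs.length_wordProd_le _)
        rw [List.length_eraseIdx_of_lt hjv] at this
        omega
      · push Not at hjv
        rw [List.eraseIdx_append_of_length_le hjv, cs.wordProd_append, mul_assoc] at e
        have := hmin (ω.eraseIdx (j - v.length))
          (fun k hk => hTω k (List.mem_of_mem_eraseIdx hk))
          (by rw [cs.wordProd_append, cs.wordProd_singleton]; exact (mul_left_cancel e).symm)
        have hle := List.length_eraseIdx_le ω (j - v.length)
        simp only [List.length_append, List.length_singleton] at this
        omega
    rw [cs.not_isRightDescent_iff] at key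
    rw [cs.wordProd_append, cs.wordProd_singleton, ← mul_assoc, key, ih hshort]
    simp [add_assoc]

end Exchange

/-- If `d` is the unique minimal-length element of the double coset `A w B`
and `A ⊆ w B w⁻¹`, then `S_A ⊆ d S_B d⁻¹`. -/
theorem stmt_3 {W : Type*} [Group W] [Fintype B] {M : CoxeterMatrix B}
    (cs : CoxeterSystem M W) (SA SB : Set B) (w d : W)
    (hd : ∃ x ∈ sp cs SA, ∃ y ∈ sp cs SB, d = x * w * y)
    (hdmin : ∀ u : W, (∃ x ∈ sp cs SA, ∃ y ∈ sp cs SB, u = x * w * y) →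
      cs.length d ≤ cs.length u)
    (hsub : sp cs SA ≤ conjSub w (sp cs SB)) :
    cs.simple '' SA ⊆ (fun x => d * x * d⁻¹) '' (cs.simple '' SB) := by
  rintro _ ⟨i, hi, rfl⟩
  obtain ⟨x, hx, y, hy, rfl⟩ := hd
  have hs : cs.simple i ∈ sp cs SA := Subgroup.subset_closure ⟨i, hi, rfl⟩
  obtain ⟨z, hz, hwz⟩ := hsub (mul_mem (mul_mem (inv_mem hx) hs) hx)
  replace hwz : w * z * w⁻¹ = x⁻¹ * cs.simple i * x := hwz
  obtain ⟨ω, hω, hωb⟩ := exists_isShortestIn cs (mul_mem (mul_mem (inv_mem hy) hz) hy)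
  have hconj : cs.simple i * (x * w * y) = x * w * y * cs.wordProd ω := by
    have hwz' : cs.simple i = x * (w * z * w⁻¹) * x⁻¹ := by
      rw [hwz]
      group
    rw [hωb, hwz']
    group
  have hlen := length_mul_wordProd_of_isShortestIn cs (d := x * w * y)
    (fun b hb => hdmin _ ⟨x, hx, y * b, mul_mem hy hb, by simp only [mul_assoc]⟩) hω
  have hle := cs.length_mul_le (cs.simple i) (x * w * y)
  rw [hconj, hlen, cs.length_simple] at hle
  match ω, hω, hconj, hle with
  | [], _, hconj, _ =>
    have h1 : cs.simple i = 1 := by simpa using hconj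
    have h2 := cs.length_simple i
    rw [h1, cs.length_one] at h2
    omega
  | [k], hω, hconj, _ =>
    refine ⟨cs.simple k, ⟨k, hω.1 k (by simp), rfl⟩, ?_⟩
    rw [cs.wordProd_singleton] at hconj
    exact mul_inv_eq_of_eq_mul hconj.symm
  | _ :: _ :: _, _, _, hle =>
    simp only [List.length_cons] at hle
    omega

end CoxFA
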